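/- arXiv:math/0410597 — 9 statements merged into one kernel-verified Lean document; each statement's English description precedes it below -/
import Mathlib

section
/- Let X be a discrete proper metric space with basepoint pt and let k ∈ ℝ. Then the set B := {φ : X → ℝ | ‖φ‖^{k+1} ≤ 1} is totally bounded with respect to the norm ‖·‖^k: for every ε > 0 there exist finitely many functions φ_1, …, φ_N ∈ B such that every φ ∈ B satisfies ‖φ − φ_i‖^k < ε for some i. Equivalently, the inclusion of the weighted ℓ¹-space Sch^{k+1}(X) into Sch^k(X) is a compact operator. -/
/-- Let `X` be a discrete proper metric space (bounded subsets are finite)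
with basepoint `pt`, and `k ∈ ℝ`. The unit ball `B` of the weighted ℓ¹-norm `‖·‖^{k+1}`
(weight `(d(x,pt)+1)^{k+1}`) is totally bounded for the norm `‖·‖^k`: for every `ε > 0`
there are finitely many `φ_1, …, φ_N ∈ B` such that every `ψ ∈ B` satisfies
`‖ψ - φ_i‖^k < ε` for some `i`.  Equivalently, the inclusion
`Sch^{k+1}(X) → Sch^k(X)` is a compact operator. -/
theorem statement4 {X : Type*} [MetricSpace X]
    (hproper : ∀ s : Set X, Bornology.IsBounded s → s.Finite)
    (pt : X) (k : ℝ) :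
    ∀ ε : ℝ, 0 < ε → ∃ (N : ℕ) (Φ : Fin N → X → ℝ),
      (∀ i, ∀ s : Finset X, ∑ x ∈ s, |Φ i x| * (dist x pt + 1) ^ (k + 1) ≤ 1) ∧
      (∀ ψ : X → ℝ, (∀ s : Finset X, ∑ x ∈ s, |ψ x| * (dist x pt + 1) ^ (k + 1) ≤ 1) →
        ∃ i, (Summable fun x => |ψ x - Φ i x| * (dist x pt + 1) ^ k) ∧
          ∑' x, |ψ x - Φ i x| * (dist x pt + 1) ^ k < ε) := by
  classical
  intro ε hε
  have hw : ∀ x : X, 0 < dist x pt + 1 := fun x => by positivity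
  have hwp : ∀ (x : X) (a : ℝ), 0 < (dist x pt + 1) ^ a := fun x a => Real.rpow_pos_of_pos (hw x) a
  let F : Finset X := (hproper (Metric.closedBall pt (4 / ε)) Metric.isBounded_closedBall).toFinset
  have hF : ∀ x, x ∉ F → 4 / ε < dist x pt := by
    intro x hx
    simpa [F] using hx
  let K : Set (F → ℝ) := {f | ∑ x, |f x| * (dist (x : X) pt + 1) ^ (k + 1) ≤ 1}
  have hK : TotallyBounded K := by
    refine TotallyBounded.subset (s₂ := Set.pi Set.univ
      (fun x : F => Set.Icc (-((dist (x : X) pt + 1) ^ (k + 1))⁻¹) (((dist (x : X) pt + 1) ^ (k + 1))⁻¹))) ?_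
      (IsCompact.totallyBounded (isCompact_univ_pi fun _ => isCompact_Icc))
    intro f hf x _
    have h1 : |f x| * (dist (x : X) pt + 1) ^ (k + 1) ≤ 1 :=
      (Finset.single_le_sum (f := fun x : F => |f x| * (dist (x : X) pt + 1) ^ (k + 1))
        (fun y _ => mul_nonneg (abs_nonneg _) (hwp y _).le) (Finset.mem_univ x)).trans hf
    rw [Set.mem_Icc, ← abs_le, ← one_div, le_div_iff₀ (hwp x _)]
    exact h1
  let S : ℝ := ∑ x ∈ F, (dist x pt + 1) ^ k
  have hS : 0 ≤ S := Finset.sum_nonneg fun x _ => (hwp x k).le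
  let δ : ℝ := ε / (4 * (S + 1))
  have hδ : 0 < δ := by positivity
  have hδS : δ * S ≤ ε / 4 := by
    have : δ * (S + 1) = ε / 4 := by
      simp only [δ]; field_simp
    nlinarith
  obtain ⟨t, htK, htf, htc⟩ := Metric.finite_approx_of_totallyBounded hK δ hδ
  obtain ⟨N, g, -, hg⟩ := htf.fin_param
  refine ⟨N, fun i x => if h : x ∈ F then g i ⟨x, h⟩ else 0, ?_, ?_⟩
  · intro i s
    have hi : g i ∈ K := htK (hg ▸ Set.mem_range_self i)
    refine le_trans ?_ hi
    rw [Finset.sum_coe_sort_eq_attach, ← Finset.sum_subset_zero_on_sdiff (s₁ := s ∩ F) (s₂ := s)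
      Finset.inter_subset_left (f := fun x => |if h : x ∈ F then g i ⟨x, h⟩ else 0| * (dist x pt + 1) ^ (k + 1)) ?_ (fun _ _ => rfl)]
    · refine (Finset.sum_le_sum_of_subset_of_nonneg Finset.inter_subset_right
        fun y _ _ => mul_nonneg (abs_nonneg _) (hwp y _).le).trans ?_
      rw [← Finset.sum_attach F]
      refine Finset.sum_le_sum fun x _ => ?_
      simp
    · intro x hx
      have : x ∉ F := by
        simp only [Finset.mem_sdiff, Finset.mem_inter] at hx
        tauto
      simp [this]
  · intro ψ hψ
    have hψK : (fun x : F => ψ x) ∈ K := by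
      change ∑ x : F, |ψ x| * (dist (x : X) pt + 1) ^ (k + 1) ≤ 1
      rw [Finset.sum_coe_sort F (fun x => |ψ x| * (dist x pt + 1) ^ (k + 1))]
      exact hψ F
    obtain ⟨f, hft, hfd⟩ := Set.mem_iUnion₂.1 (htc hψK)
    rw [← hg] at hft
    obtain ⟨i, rfl⟩ := hft
    refine ⟨i, ?_⟩
    have hpt : ∀ x, |ψ x - (if h : x ∈ F then g i ⟨x, h⟩ else 0)| * (dist x pt + 1) ^ k ≤
        ε / 4 * (|ψ x| * (dist x pt + 1) ^ (k + 1)) +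
          (if x ∈ F then δ * (dist x pt + 1) ^ k else 0) := by
      intro x
      have h0 : 0 ≤ |ψ x| * (dist x pt + 1) ^ k := mul_nonneg (abs_nonneg _) (hwp x _).le
      have h1 : 0 ≤ |ψ x| * (dist x pt + 1) ^ (k + 1) := mul_nonneg (abs_nonneg _) (hwp x _).le
      by_cases h : x ∈ F
      · simp only [h, dite_true, if_true]
        have h2 : |ψ x - g i ⟨x, h⟩| ≤ δ := by
          have := (dist_le_pi_dist (fun x : F => ψ x) (g i) ⟨x, h⟩).trans (Metric.mem_ball.1 hfd).le
          simpa [Real.dist_eq] using this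
        have h3 := mul_le_mul_of_nonneg_right h2 (hwp x k).le
        have h4 : 0 ≤ ε / 4 * (|ψ x| * (dist x pt + 1) ^ (k + 1)) := by positivity
        linarith
      · simp only [h, dite_false, if_false, sub_zero, add_zero]
        rw [Real.rpow_add_one (hw x).ne']
        have h2 : 1 ≤ ε / 4 * (dist x pt + 1) := by
          have := hF x h
          rw [div_lt_iff₀ hε] at this
          linarith
        nlinarith
    have hsum : ∀ s : Finset X, ∑ x ∈ s, |ψ x - (if h : x ∈ F then g i ⟨x, h⟩ else 0)| *
        (dist x pt + 1) ^ k ≤ ε / 2 := by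
      intro s
      refine (Finset.sum_le_sum fun x _ => hpt x).trans ?_
      rw [Finset.sum_add_distrib, ← Finset.mul_sum, ← Finset.sum_filter, ← Finset.mul_sum]
      have h1 := mul_le_mul_of_nonneg_left (hψ s) (by positivity : 0 ≤ ε / 4)
      have h2 : ∑ x ∈ s with x ∈ F, (dist x pt + 1) ^ k ≤ S :=
        Finset.sum_le_sum_of_subset_of_nonneg (fun x hx => (Finset.mem_filter.1 hx).2)
          fun y _ _ => (hwp y k).le
      have h3 := mul_le_mul_of_nonneg_left h2 hδ.le
      linarith
    have hnn : ∀ x, 0 ≤ |ψ x - (if h : x ∈ F then g i ⟨x, h⟩ else 0)| * (dist x pt + 1) ^ k :=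
      fun x => mul_nonneg (abs_nonneg _) (hwp x _).le
    refine ⟨summable_of_sum_le hnn hsum, ?_⟩
    exact (Real.tsum_le_of_sum_le hnn hsum).trans_lt (by linarith)
end

section
/- Let X be a discrete proper metric space with basepoint pt and let 0 < β < α. Then the set B := {φ : X → ℝ | ⦀φ⦀_α ≤ 1} is totally bounded with respect to the norm ⦀·⦀_β: for every ε > 0 there exist finitely many functions φ_1, …, φ_N ∈ B such that every φ ∈ B satisfies ⦀φ − φ_i⦀_β < ε for some i. Equivalently, the inclusion ℓ_1(X, α^ℓ) → ℓ_1(X, β^ℓ) is a compact operator. -/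
/-- Let `X` be a discrete proper metric space (bounded subsets are finite)
with basepoint `pt`, and `0 < β < α`. The unit ball `B` of the weighted ℓ¹-norm `⦀·⦀_α`
(weight `α^{d(x,pt)}`) is totally bounded for the norm `⦀·⦀_β`: for every `ε > 0`
there are finitely many `φ_1, …, φ_N ∈ B` such that every `ψ ∈ B` satisfies
`⦀ψ - φ_i⦀_β < ε` for some `i`.  Equivalently, the inclusion
`ℓ_1(X, α^ℓ) → ℓ_1(X, β^ℓ)` is a compact operator. -/
theorem statement5 {X : Type*} [MetricSpace X]
    (hproper : ∀ s : Set X, Bornology.IsBounded s → s.Finite)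
    (pt : X) (α β : ℝ) (hβ : 0 < β) (hβα : β < α) :
    ∀ ε : ℝ, 0 < ε → ∃ (N : ℕ) (Φ : Fin N → X → ℝ),
      (∀ i, ∀ s : Finset X, ∑ x ∈ s, |Φ i x| * α ^ dist x pt ≤ 1) ∧
      (∀ ψ : X → ℝ, (∀ s : Finset X, ∑ x ∈ s, |ψ x| * α ^ dist x pt ≤ 1) →
        ∃ i, (Summable fun x => |ψ x - Φ i x| * β ^ dist x pt) ∧
          ∑' x, |ψ x - Φ i x| * β ^ dist x pt < ε) := by
  classical
  intro ε hε
  have hα : 0 < α := hβ.trans hβα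
  have hq0 : 0 < β / α := div_pos hβ hα
  have hq1 : β / α < 1 := (div_lt_one hα).2 hβα
  obtain ⟨R, hR⟩ := exists_pow_lt_of_lt_one (show 0 < ε / 8 by linarith) hq1
  have hfin : (Metric.closedBall pt (R : ℝ)).Finite := hproper _ Metric.isBounded_closedBall
  set F : Finset X := hfin.toFinset with hF
  have hmem : ∀ x, x ∈ F ↔ dist x pt ≤ R := by
    intro x; simp [hF]
  have hout : ∀ x, x ∉ F → β ^ dist x pt ≤ α ^ dist x pt * (β / α) ^ R := by
    intro x hx
    rw [hmem, not_le] at hx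
    have h1 : β ^ dist x pt = α ^ dist x pt * (β / α) ^ dist x pt := by
      rw [← Real.mul_rpow hα.le hq0.le, mul_div_cancel₀ _ hα.ne']
    rw [h1, ← Real.rpow_natCast (β / α) R]
    have h2 := Real.rpow_le_rpow_of_exponent_ge hq0 hq1.le hx.le
    have h3 : 0 < α ^ dist x pt := Real.rpow_pos_of_pos hα _
    gcongr
  set B : Set (X → ℝ) := {ψ | ∀ s : Finset X, ∑ x ∈ s, |ψ x| * α ^ dist x pt ≤ 1} with hB
  set res : (X → ℝ) → (F → ℝ) := fun ψ x => ψ x with hres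
  have htb : TotallyBounded (res '' B) := by
    have hc : IsCompact (Set.pi Set.univ
        (fun x : F => Set.Icc (-(α ^ dist (x : X) pt)⁻¹) ((α ^ dist (x : X) pt)⁻¹))) :=
      isCompact_univ_pi fun _ => isCompact_Icc
    refine hc.totallyBounded.subset ?_
    rintro _ ⟨ψ, hψ, rfl⟩ x _
    have h := hψ {(x : X)}
    rw [Finset.sum_singleton] at h
    have h3 : 0 < α ^ dist (x : X) pt := Real.rpow_pos_of_pos hα _
    rw [Set.mem_Icc, ← abs_le]
    rw [← one_div, le_div_iff₀ h3]
    exact h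
  set S : ℝ := ∑ x ∈ F, β ^ dist x pt with hS
  have hβp : ∀ x, 0 < β ^ dist x pt := fun x => Real.rpow_pos_of_pos hβ _
  have hαp : ∀ x, 0 < α ^ dist x pt := fun x => Real.rpow_pos_of_pos hα _
  have hS0 : 0 ≤ S := Finset.sum_nonneg fun x _ => (hβp x).le
  set δ : ℝ := ε / (2 * (S + 1)) with hδ
  have hδ0 : 0 < δ := by positivity
  have hδS : δ * S ≤ ε / 2 := by
    rw [hδ, div_mul_eq_mul_div, div_le_div_iff₀ (by positivity) (by norm_num)]
    nlinarith
  obtain ⟨t, htB, htf, hcov⟩ := Metric.finite_approx_of_totallyBounded htb δ hδ0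
  have hch : ∀ y : t, ∃ φ ∈ B, res φ = y := fun y => htB y.2
  choose G hGB hG using hch
  have := htf.fintype
  let e := Fintype.equivFin t
  refine ⟨Fintype.card t, fun i => G (e.symm i), fun i => hGB _, ?_⟩
  intro ψ hψ
  have hc := hcov ⟨ψ, hψ, rfl⟩
  simp only [Set.mem_iUnion, Metric.mem_ball] at hc
  obtain ⟨y, hy, hd⟩ := hc
  refine ⟨e ⟨y, hy⟩, ?_⟩
  simp only [Equiv.symm_apply_apply]
  set φ := G ⟨y, hy⟩ with hφ
  have hφB : ∀ s : Finset X, ∑ x ∈ s, |φ x| * α ^ dist x pt ≤ 1 := hGB ⟨y, hy⟩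
  have hclose : ∀ x ∈ F, |ψ x - φ x| ≤ δ := by
    intro x hx
    have h1 := (dist_le_pi_dist (res ψ) y ⟨x, hx⟩).trans hd.le
    have h2 : res φ = y := hG ⟨y, hy⟩
    rw [← h2] at h1
    exact h1
  have hr0 : 0 < (β / α) ^ R := pow_pos hq0 R
  have hpt : ∀ x, |ψ x - φ x| * β ^ dist x pt ≤ (if x ∈ F then δ * β ^ dist x pt else 0)
      + (|ψ x| * α ^ dist x pt + |φ x| * α ^ dist x pt) * (β / α) ^ R := by
    intro x
    have hα' := hαp x
    have hβ' := hβp x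
    have hn : 0 ≤ (|ψ x| * α ^ dist x pt + |φ x| * α ^ dist x pt) * (β / α) ^ R := by positivity
    split_ifs with hx
    · have := mul_le_mul_of_nonneg_right (hclose x hx) hβ'.le
      linarith
    · have h1 := mul_le_mul (abs_sub (ψ x) (φ x)) (hout x hx) hβ'.le (by positivity)
      linarith
  have hsum : ∀ s : Finset X, ∑ x ∈ s, |ψ x - φ x| * β ^ dist x pt ≤ ε / 2 + ε / 4 := by
    intro s
    refine (Finset.sum_le_sum fun x _ => hpt x).trans ?_
    rw [Finset.sum_add_distrib, ← Finset.sum_mul, Finset.sum_add_distrib, ← Finset.sum_filter]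
    have h1 : ∑ x ∈ s with x ∈ F, δ * β ^ dist x pt ≤ δ * S := by
      rw [hS, Finset.mul_sum]
      refine Finset.sum_le_sum_of_subset_of_nonneg (fun x hx => (Finset.mem_filter.1 hx).2) ?_
      intro x _ _
      exact mul_nonneg hδ0.le (hβp x).le
    have h2 := hψ s
    have h3 := hφB s
    have h4 := mul_le_mul_of_nonneg_right (add_le_add h2 h3) hr0.le
    linarith
  have hnn : ∀ x, 0 ≤ |ψ x - φ x| * β ^ dist x pt := fun x => mul_nonneg (abs_nonneg _) (hβp x).le
  refine ⟨summable_of_sum_le hnn hsum, ?_⟩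
  have := Real.tsum_le_of_sum_le hnn hsum
  linarith
end

section
/- Let X and Y be discrete proper metric spaces with basepoints, and let f : X → Y be quasi-Lipschitz, i.e., there is C > 0 with d(f(x), f(x')) ≤ C·(d(x,x') + 1) for all x, x' ∈ X. Then for all n ∈ ℕ, k ≥ 0 and R > 0 there exist R' > 0 and M ≥ 0 such that for every R-controlled φ ∈ C_n(X): the chain f_*φ ∈ C_n(Y) is R'-controlled and ‖f_*φ‖^k_n ≤ M·‖φ‖^k_n. In particular f_* extends to a bounded linear operator on the tempered chain spaces. -/
open Finsupp

/-- A tuple is degenerate if two consecutive entries agree. -/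
def IsDegen {X : Type*} {n : ℕ} (t : Fin (n + 1) → X) : Prop :=
  ∃ j : Fin n, t j.castSucc = t j.succ

open Classical in
/-- The image of a basis vector under the projection `p` killing degenerate tuples. -/
noncomputable def csingle {X : Type*} {n : ℕ} (t : Fin (n + 1) → X) :
    (Fin (n + 1) → X) →₀ ℝ :=
  if IsDegen t then 0 else Finsupp.single t 1

/-- Membership in `C_n(X)`: finitely supported chains vanishing on degenerate tuples. -/
def MemC {X : Type*} {n : ℕ} (φ : (Fin (n + 1) → X) →₀ ℝ) : Prop :=
  ∀ t, IsDegen t → φ t = 0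

/-- The simplicial boundary map `δ : C_{n+1}(X) → C_n(X)`. -/
noncomputable def bdry {X : Type*} {n : ℕ} :
    ((Fin (n + 2) → X) →₀ ℝ) →ₗ[ℝ] ((Fin (n + 1) → X) →₀ ℝ) :=
  Finsupp.linearCombination ℝ
    (fun t => ∑ j : Fin (n + 2), ((-1 : ℝ) ^ (j : ℕ)) • csingle (t ∘ j.succAbove))

/-- The induced chain map `f_* : C_n(X) → C_n(Y)`. -/
noncomputable def pushf {X Y : Type*} (f : X → Y) {n : ℕ} :
    ((Fin (n + 1) → X) →₀ ℝ) →ₗ[ℝ] ((Fin (n + 1) → Y) →₀ ℝ) :=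
  Finsupp.linearCombination ℝ (fun t => csingle (f ∘ t))

/-- The prism tuple `(f(x_0),…,f(x_j),f'(x_j),…,f'(x_n))`. -/
def prism {X Y : Type*} (f f' : X → Y) {n : ℕ} (j : Fin (n + 1)) (t : Fin (n + 1) → X) :
    Fin (n + 2) → Y :=
  fun i =>
    if h : (i : ℕ) ≤ (j : ℕ) then f (t ⟨i, by have := j.isLt; omega⟩)
    else f' (t ⟨(i : ℕ) - 1, by have := i.isLt; omega⟩)

/-- The elementary homotopy `H(f,f') : C_n(X) → C_{n+1}(Y)`. -/
noncomputable def hmap {X Y : Type*} (f f' : X → Y) {n : ℕ} :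
    ((Fin (n + 1) → X) →₀ ℝ) →ₗ[ℝ] ((Fin (n + 2) → Y) →₀ ℝ) :=
  Finsupp.linearCombination ℝ
    (fun t => ∑ j : Fin (n + 1), ((-1 : ℝ) ^ (j : ℕ)) • csingle (prism f f' j t))

/-- `φ` is `R`-controlled: it vanishes on tuples with two entries at distance `> R`. -/
def Controlled {X : Type*} [MetricSpace X] (R : ℝ) {n : ℕ}
    (φ : (Fin (n + 1) → X) →₀ ℝ) : Prop :=
  ∀ t : Fin (n + 1) → X, (∃ i j, R < dist (t i) (t j)) → φ t = 0

/-- The weighted ℓ¹-norm `‖φ‖^k_n = Σ_t |φ(t)|·(d(t_0,pt)+1)^k` on `C_n(X)`. -/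
noncomputable def chainNorm {X : Type*} [MetricSpace X] (pt : X) (k : ℝ) {n : ℕ}
    (φ : (Fin (n + 1) → X) →₀ ℝ) : ℝ :=
  ∑ t ∈ φ.support, |φ t| * (dist (t 0) pt + 1) ^ k

theorem pushf_apply_aux {X Y : Type*} (f : X → Y) {n : ℕ} (φ : (Fin (n + 1) → X) →₀ ℝ)
    (t : Fin (n + 1) → Y) :
    pushf f φ t = ∑ s ∈ φ.support, φ s * csingle (f ∘ s) t := by
  simp [pushf, Finsupp.linearCombination_apply, Finsupp.sum, Finsupp.finsetSum_apply]

theorem csingle_nonneg_aux {Y : Type*} {n : ℕ} (u t : Fin (n + 1) → Y) :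
    0 ≤ csingle u t := by
  classical
  unfold csingle
  split_ifs
  · simp
  · rw [Finsupp.single_apply]; split_ifs <;> norm_num

theorem csingle_ne_aux {Y : Type*} {n : ℕ} (u t : Fin (n + 1) → Y) (h : u ≠ t) :
    csingle u t = 0 := by
  classical
  unfold csingle
  split_ifs
  · simp
  · rw [Finsupp.single_apply, if_neg h]

theorem csingle_le_aux {Y : Type*} {n : ℕ} (u t : Fin (n + 1) → Y) :
    csingle u t ≤ 1 := by
  classical
  unfold csingle
  split_ifs
  · simp
  · rw [Finsupp.single_apply]; split_ifs <;> norm_num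

theorem csingle_sum_aux {Y : Type*} {n : ℕ} (T : Finset (Fin (n + 1) → Y))
    (u : Fin (n + 1) → Y) (w : (Fin (n + 1) → Y) → ℝ) (hw : ∀ t, 0 ≤ w t) :
    ∑ t ∈ T, csingle u t * w t ≤ w u := by
  classical
  by_cases hu : u ∈ T
  · rw [Finset.sum_eq_single_of_mem u hu]
    · have := mul_le_mul_of_nonneg_right (csingle_le_aux u u) (hw u)
      linarith
    · intro b _ hb
      rw [csingle_ne_aux u b hb.symm, zero_mul]
  · rw [Finset.sum_eq_zero]
    · exact hw u
    · intro b hb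
      rw [csingle_ne_aux u b (fun h => hu (h ▸ hb)), zero_mul]

/-- Let `X, Y` be discrete proper metric spaces with basepoints and
`f : X → Y` quasi-Lipschitz (`d(f(x),f(x')) ≤ C·(d(x,x')+1)`).  Then for all `n`, `k ≥ 0`
and `R > 0` there are `R' > 0` and `M ≥ 0` such that for every `R`-controlled `φ ∈ C_n(X)`,
the chain `f_*φ ∈ C_n(Y)` is `R'`-controlled and `‖f_*φ‖^k_n ≤ M·‖φ‖^k_n`; hence `f_*`
extends to a bounded operator on the tempered chain spaces. -/
theorem statement7 {X Y : Type*} [MetricSpace X] [MetricSpace Y]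
    (hX : ∀ s : Set X, Bornology.IsBounded s → s.Finite)
    (hY : ∀ s : Set Y, Bornology.IsBounded s → s.Finite)
    (ptX : X) (ptY : Y) (f : X → Y) (C : ℝ) (hC : 0 < C)
    (hf : ∀ x x' : X, dist (f x) (f x') ≤ C * (dist x x' + 1)) :
    ∀ (n : ℕ) (k R : ℝ), 0 ≤ k → 0 < R →
      ∃ R' > (0 : ℝ), ∃ M ≥ (0 : ℝ), ∀ φ : (Fin (n + 1) → X) →₀ ℝ,
        MemC φ → Controlled R φ →
          Controlled R' (pushf f φ) ∧
          chainNorm ptY k (pushf f φ) ≤ M * chainNorm ptX k φ := by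
  intro n k R hk hR
  have hD : 0 ≤ dist (f ptX) ptY := dist_nonneg
  refine ⟨C * (R + 1), by positivity, (C + dist (f ptX) ptY + 1) ^ k, by positivity, ?_⟩
  intro φ _ hφ
  constructor
  · rintro t ⟨i, j, hij⟩
    rw [pushf_apply_aux]
    refine Finset.sum_eq_zero fun s _ => ?_
    by_cases hs : f ∘ s = t
    · subst hs
      have h1 : R < dist (s i) (s j) := by
        have h2 := lt_of_lt_of_le hij (hf (s i) (s j))
        have := lt_of_mul_lt_mul_left h2 hC.le
        linarith
      rw [hφ s ⟨i, j, h1⟩, zero_mul]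
    · rw [csingle_ne_aux _ _ hs, mul_zero]
  · have hw : ∀ t : Fin (n + 1) → Y, 0 ≤ (dist (t 0) ptY + 1) ^ k := fun t => by positivity
    unfold chainNorm
    calc ∑ t ∈ (pushf f φ).support, |pushf f φ t| * (dist (t 0) ptY + 1) ^ k
        ≤ ∑ t ∈ (pushf f φ).support, ∑ s ∈ φ.support,
            |φ s| * (csingle (f ∘ s) t * (dist (t 0) ptY + 1) ^ k) := by
          refine Finset.sum_le_sum fun t _ => ?_
          simp only [← mul_assoc]
          rw [← Finset.sum_mul]
          refine mul_le_mul_of_nonneg_right ?_ (hw t)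
          rw [pushf_apply_aux]
          refine (Finset.abs_sum_le_sum_abs _ _).trans (le_of_eq ?_)
          refine Finset.sum_congr rfl fun s _ => ?_
          rw [abs_mul, abs_of_nonneg (csingle_nonneg_aux _ _)]
      _ = ∑ s ∈ φ.support, |φ s| *
            ∑ t ∈ (pushf f φ).support, csingle (f ∘ s) t * (dist (t 0) ptY + 1) ^ k := by
          rw [Finset.sum_comm]
          simp only [Finset.mul_sum]
      _ ≤ ∑ s ∈ φ.support, |φ s| * (dist ((f ∘ s) 0) ptY + 1) ^ k := by
          refine Finset.sum_le_sum fun s _ => ?_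
          exact mul_le_mul_of_nonneg_left
            (csingle_sum_aux _ _ (fun t => (dist (t 0) ptY + 1) ^ k) hw) (abs_nonneg _)
      _ ≤ _ := by
          rw [Finset.mul_sum]
          refine Finset.sum_le_sum fun s _ => ?_
          have hd : 0 ≤ dist (s 0) ptX := dist_nonneg
          have h1 : dist ((f ∘ s) 0) ptY + 1
              ≤ (C + dist (f ptX) ptY + 1) * (dist (s 0) ptX + 1) := by
            have h2 := dist_triangle (f (s 0)) (f ptX) ptY
            have h3 := hf (s 0) ptX
            have h4 := mul_nonneg hD hd
            simp only [Function.comp]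
            nlinarith
          have h5 := Real.rpow_le_rpow (by positivity) h1 hk
          rw [Real.mul_rpow (by positivity) (by positivity)] at h5
          have h6 := mul_le_mul_of_nonneg_left h5 (abs_nonneg (φ s))
          linarith
end

section
/- Let X and Y be discrete proper metric spaces with basepoints, and let f, f' : X → Y be two maps that are quasi-Lipschitz with common constant C (d(f(x),f(x')) ≤ C·(d(x,x')+1) and d(f'(x),f'(x')) ≤ C·(d(x,x')+1) for all x, x') and close in the sense that d(f(x), f'(x)) ≤ S for all x ∈ X and some S ≥ 0. Then for all n ∈ ℕ, k ≥ 0 and R > 0 there exist R' > 0 and M ≥ 0 such that for every R-controlled φ ∈ C_n(X): the chain H(f,f')φ ∈ C_{n+1}(Y) is R'-controlled and ‖H(f,f')φ‖^k_{n+1} ≤ M·‖φ‖^k_n. In particular H(f,f') extends to a bounded operator on the tempered chain spaces, so close quasi-Lipschitz maps induce chain homotopic bounded chain maps. -/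
open Finsupp

lemma chainNorm_eq_of_subset {X : Type*} [MetricSpace X] (pt : X) (k : ℝ) {n : ℕ}
    (φ : (Fin (n + 1) → X) →₀ ℝ) (s : Finset (Fin (n + 1) → X)) (h : φ.support ⊆ s) :
    chainNorm pt k φ = ∑ t ∈ s, |φ t| * (dist (t 0) pt + 1) ^ k := by
  unfold chainNorm
  apply Finset.sum_subset h
  intro t _ ht
  simp [Finsupp.notMem_support_iff.mp ht]

lemma chainNorm_add_le {X : Type*} [MetricSpace X] (pt : X) (k : ℝ) {n : ℕ}
    (φ ψ : (Fin (n + 1) → X) →₀ ℝ) :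
    chainNorm pt k (φ + ψ) ≤ chainNorm pt k φ + chainNorm pt k ψ := by
  classical
  rw [chainNorm_eq_of_subset pt k (φ + ψ) (φ.support ∪ ψ.support) Finsupp.support_add,
    chainNorm_eq_of_subset pt k φ (φ.support ∪ ψ.support) Finset.subset_union_left,
    chainNorm_eq_of_subset pt k ψ (φ.support ∪ ψ.support) Finset.subset_union_right,
    ← Finset.sum_add_distrib]
  apply Finset.sum_le_sum
  intro t _
  rw [← add_mul]
  apply mul_le_mul_of_nonneg_right
  · rw [Finsupp.add_apply]
    exact abs_add_le _ _
  · positivity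

lemma chainNorm_zero {X : Type*} [MetricSpace X] (pt : X) (k : ℝ) {n : ℕ} :
    chainNorm pt k (0 : (Fin (n + 1) → X) →₀ ℝ) = 0 := by
  simp [chainNorm]

lemma chainNorm_sum_le {X ι : Type*} [MetricSpace X] (pt : X) (k : ℝ) {n : ℕ}
    (s : Finset ι) (φ : ι → ((Fin (n + 1) → X) →₀ ℝ)) :
    chainNorm pt k (∑ i ∈ s, φ i) ≤ ∑ i ∈ s, chainNorm pt k (φ i) := by
  classical
  induction s using Finset.induction_on with
  | empty => simp [chainNorm_zero]
  | insert a s ha ih =>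
    rw [Finset.sum_insert ha, Finset.sum_insert ha]
    exact (chainNorm_add_le _ _ _ _).trans (by linarith)

lemma chainNorm_smul {X : Type*} [MetricSpace X] (pt : X) (k : ℝ) {n : ℕ} (c : ℝ)
    (φ : (Fin (n + 1) → X) →₀ ℝ) :
    chainNorm pt k (c • φ) = |c| * chainNorm pt k φ := by
  rw [chainNorm_eq_of_subset pt k (c • φ) φ.support Finsupp.support_smul]
  unfold chainNorm
  rw [Finset.mul_sum]
  apply Finset.sum_congr rfl
  intro t _
  rw [Finsupp.smul_apply, smul_eq_mul, abs_mul, mul_assoc]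

lemma chainNorm_csingle_le {X : Type*} [MetricSpace X] (pt : X) (k : ℝ) {n : ℕ}
    (t : Fin (n + 1) → X) :
    chainNorm pt k (csingle t) ≤ (dist (t 0) pt + 1) ^ k := by
  classical
  unfold csingle
  split_ifs
  · rw [chainNorm_zero]; positivity
  · rw [chainNorm_eq_of_subset pt k _ {t} Finsupp.support_single_subset]
    simp

lemma csingle_apply_ne {X : Type*} {n : ℕ} (t s : Fin (n + 1) → X) (h : t ≠ s) :
    csingle t s = 0 := by
  classical
  unfold csingle
  split_ifs
  · rfl
  · exact Finsupp.single_eq_of_ne (Ne.symm h)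

lemma prism_dist_le {X Y : Type*} [MetricSpace X] [MetricSpace Y]
    (f f' : X → Y) (C : ℝ) (hC : 0 < C)
    (hf : ∀ x x' : X, dist (f x) (f x') ≤ C * (dist x x' + 1))
    (hf' : ∀ x x' : X, dist (f' x) (f' x') ≤ C * (dist x x' + 1))
    (S : ℝ) (hS : 0 ≤ S) (hclose : ∀ x : X, dist (f x) (f' x) ≤ S)
    {n : ℕ} (R : ℝ) (t : Fin (n + 1) → X) (ht : ∀ i j, dist (t i) (t j) ≤ R)
    (j : Fin (n + 1)) (a b : Fin (n + 2)) :
    dist (prism f f' j t a) (prism f f' j t b) ≤ C * (R + 1) + S := by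
  have key : ∀ i l, C * (dist (t i) (t l) + 1) ≤ C * (R + 1) := fun i l =>
    mul_le_mul_of_nonneg_left (by linarith [ht i l]) hC.le
  have mixed : ∀ i l, dist (f (t i)) (f' (t l)) ≤ C * (R + 1) + S := fun i l => by
    linarith [dist_triangle (f (t i)) (f (t l)) (f' (t l)), hf (t i) (t l), key i l,
      hclose (t l)]
  unfold prism
  split_ifs
  · exact (hf _ _).trans ((key _ _).trans (by linarith))
  · exact mixed _ _
  · rw [dist_comm]; exact mixed _ _
  · exact (hf' _ _).trans ((key _ _).trans (by linarith))

/-- Let `X, Y` be discrete proper metric spaces with basepoints and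
`f, f' : X → Y` quasi-Lipschitz with common constant `C` and close (`d(f(x),f'(x)) ≤ S`).
Then for all `n`, `k ≥ 0` and `R > 0` there are `R' > 0` and `M ≥ 0` such that for every
`R`-controlled `φ ∈ C_n(X)`, the chain `H(f,f')φ ∈ C_{n+1}(Y)` is `R'`-controlled and
`‖H(f,f')φ‖^k_{n+1} ≤ M·‖φ‖^k_n`; hence `H(f,f')` extends to a bounded operator on the
tempered chain spaces, so close quasi-Lipschitz maps induce chain homotopic chain maps. -/
theorem statement8 {X Y : Type*} [MetricSpace X] [MetricSpace Y]
    (hX : ∀ s : Set X, Bornology.IsBounded s → s.Finite)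
    (hY : ∀ s : Set Y, Bornology.IsBounded s → s.Finite)
    (ptX : X) (ptY : Y) (f f' : X → Y) (C : ℝ) (hC : 0 < C)
    (hf : ∀ x x' : X, dist (f x) (f x') ≤ C * (dist x x' + 1))
    (hf' : ∀ x x' : X, dist (f' x) (f' x') ≤ C * (dist x x' + 1))
    (S : ℝ) (hS : 0 ≤ S) (hclose : ∀ x : X, dist (f x) (f' x) ≤ S) :
    ∀ (n : ℕ) (k R : ℝ), 0 ≤ k → 0 < R →
      ∃ R' > (0 : ℝ), ∃ M ≥ (0 : ℝ), ∀ φ : (Fin (n + 1) → X) →₀ ℝ,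
        MemC φ → Controlled R φ →
          Controlled R' (hmap f f' φ) ∧
          chainNorm ptY k (hmap f f' φ) ≤ M * chainNorm ptX k φ := by
  intro n k R hk hR
  set A : ℝ := C + dist (f ptX) ptY + 1 with hA
  have hApos : 0 < A := by positivity
  refine ⟨C * (R + 1) + S, by positivity, (n + 1) * A ^ k, by positivity, ?_⟩
  intro φ _ hφ
  have hexp : hmap f f' φ = ∑ t ∈ φ.support, φ t •
      ∑ j : Fin (n + 1), ((-1 : ℝ) ^ (j : ℕ)) • csingle (prism f f' j t) := by
    unfold hmap
    rw [Finsupp.linearCombination_apply, Finsupp.sum]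
  rw [hexp]
  constructor
  · rintro s ⟨a, b, hab⟩
    rw [Finsupp.finsetSum_apply]
    apply Finset.sum_eq_zero
    intro t hts
    have ht : ∀ i j, dist (t i) (t j) ≤ R := by
      intro i j
      by_contra hlt
      exact (Finsupp.mem_support_iff.mp hts) (hφ t ⟨i, j, not_le.mp hlt⟩)
    rw [Finsupp.smul_apply, Finsupp.finsetSum_apply, Finset.sum_eq_zero, smul_zero]
    intro j _
    rw [Finsupp.smul_apply, csingle_apply_ne, smul_zero]
    rintro rfl
    exact absurd (prism_dist_le f f' C hC hf hf' S hS hclose R t ht j a b) (not_le.mpr hab)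
  · refine (chainNorm_sum_le _ _ _ _).trans ?_
    unfold chainNorm
    rw [Finset.mul_sum]
    apply Finset.sum_le_sum
    intro t _
    change chainNorm ptY k _ ≤ _
    rw [chainNorm_smul]
    have hw : (dist (f (t 0)) ptY + 1) ^ k ≤ A ^ k * (dist (t 0) ptX + 1) ^ k := by
      rw [← Real.mul_rpow hApos.le (by positivity)]
      apply Real.rpow_le_rpow (by positivity) _ hk
      have h1 := dist_triangle (f (t 0)) (f ptX) ptY
      have h2 := hf (t 0) ptX
      have h3 : 0 ≤ dist (f ptX) ptY * dist (t 0) ptX := by positivity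
      have h4 : 0 ≤ dist (t 0) ptX := dist_nonneg
      rw [hA]
      nlinarith
    have hin : chainNorm ptY k (∑ j : Fin (n + 1),
        ((-1 : ℝ) ^ (j : ℕ)) • csingle (prism f f' j t)) ≤
        (n + 1) * (A ^ k * (dist (t 0) ptX + 1) ^ k) := by
      refine (chainNorm_sum_le _ _ _ _).trans ?_
      have hj : ∀ j ∈ (Finset.univ : Finset (Fin (n + 1))),
          chainNorm ptY k (((-1 : ℝ) ^ (j : ℕ)) • csingle (prism f f' j t)) ≤
          A ^ k * (dist (t 0) ptX + 1) ^ k := by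
        intro j _
        rw [chainNorm_smul, abs_pow, abs_neg, abs_one, one_pow, one_mul]
        refine (chainNorm_csingle_le _ _ _).trans ?_
        have h0 : prism f f' j t 0 = f (t 0) := by simp [prism]
        rw [h0]
        exact hw
      refine (Finset.sum_le_card_nsmul _ _ _ hj).trans (le_of_eq ?_)
      simp
    calc _ ≤ |φ t| * ((n + 1) * (A ^ k * (dist (t 0) ptX + 1) ^ k)) :=
          mul_le_mul_of_nonneg_left hin (abs_nonneg _)
      _ = _ := by ring
end

section
/- Let X and Y be discrete proper metric spaces with basepoints, and let h : X → Y be a quasi-isometry: there is C ≥ 1 such that C⁻¹·d(x,x') − C ≤ d(h(x), h(x')) ≤ C·d(x,x') + C for all x, x' ∈ X, and every y ∈ Y lies within distance C of h(X). If X admits a combing of polynomial growth of order m, then Y admits a combing of polynomial growth of order m. In particular, the existence of a combing of polynomial growth of order m is independent of the chosen basepoint and is a quasi-isometry invariant. -/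
/-- `X` admits a combing with basepoint `pt` of polynomial growth of order `m`:
a sequence of maps `f_i : X → X` with `f_0 = const pt`, pointwise stabilising at the
identity, uniformly quasi-Lipschitz, with consecutive maps uniformly close, and such that
`J(x) = #{i | f_i(x) ≠ f_{i+1}(x)}` is bounded by `C'·(d(x,pt)+1)^m`. -/
def HasPolyCombing {X : Type*} [MetricSpace X] (pt : X) (m : ℕ) : Prop :=
  ∃ f : ℕ → X → X,
    (∀ x, f 0 x = pt) ∧
    (∀ x, ∃ N, ∀ i ≥ N, f i x = x) ∧
    (∃ C > (0 : ℝ), ∀ (i : ℕ) (x y : X), dist (f i x) (f i y) ≤ C * (dist x y + 1)) ∧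
    (∃ S : ℝ, ∀ (i : ℕ) (x : X), dist (f i x) (f (i + 1) x) ≤ S) ∧
    (∃ C' > (0 : ℝ), ∀ x : X,
      (Set.ncard {i : ℕ | f i x ≠ f (i + 1) x} : ℝ) ≤ C' * (dist x pt + 1) ^ m)

/-- Let `X, Y` be discrete proper metric spaces with basepoints and
`h : X → Y` a quasi-isometry.  If `X` admits a combing of polynomial growth of order `m`,
then so does `Y`; in particular, the existence of such a combing is independent of the
basepoint and is a quasi-isometry invariant. -/
theorem statement11 {X Y : Type*} [MetricSpace X] [MetricSpace Y]
    (hX : ∀ s : Set X, Bornology.IsBounded s → s.Finite)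
    (hY : ∀ s : Set Y, Bornology.IsBounded s → s.Finite)
    (ptX : X) (ptY : Y) (h : X → Y) (C : ℝ) (hC : 1 ≤ C)
    (hlow : ∀ x x' : X, C⁻¹ * dist x x' - C ≤ dist (h x) (h x'))
    (hup : ∀ x x' : X, dist (h x) (h x') ≤ C * dist x x' + C)
    (hdense : ∀ y : Y, ∃ x : X, dist y (h x) ≤ C)
    (m : ℕ) (hcomb : HasPolyCombing ptX m) :
    HasPolyCombing ptY m := by
  classical
  obtain ⟨f, h0, hN, ⟨A, hA, hlip⟩, ⟨S, hS⟩, ⟨C', hC', hJ⟩⟩ := hcomb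
  choose g hg using hdense
  have hC0 : 0 < C := by linarith
  set P := dist ptY (h ptX) with hP
  have hP0 : 0 ≤ P := dist_nonneg
  have hlow' : ∀ x x', dist x x' ≤ C * (dist (h x) (h x') + C) := by
    intro x x'
    have h1 := hlow x x'
    have h2 : C⁻¹ * dist x x' ≤ dist (h x) (h x') + C := by linarith
    have h3 := mul_le_mul_of_nonneg_left h2 hC0.le
    rwa [mul_inv_cancel_left₀ hC0.ne'] at h3
  obtain ⟨F, hF⟩ : ∃ F : ℕ → Y → Y, F = fun i y =>
    if i = 0 then ptY else if f i (g y) = g y then y else h (f i (g y)) := ⟨_, rfl⟩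
  have hclose : ∀ i y, dist (F i y) (h (f i (g y))) ≤ C + P := by
    intro i y
    simp only [hF]
    split_ifs with h1 h2
    · rw [h1, h0]; linarith
    · rw [h2]; linarith [hg y]
    · rw [dist_self]; linarith
  have hclose2 : ∀ i j x y, dist (F i x) (F j y) ≤
      2 * (C + P) + (C * dist (f i (g x)) (f j (g y)) + C) := by
    intro i j x y
    have h1 := dist_triangle4 (F i x) (h (f i (g x))) (h (f j (g y))) (F j y)
    have h2 := hclose i x
    have h3 := hclose j y
    rw [dist_comm] at h3
    linarith [hup (f i (g x)) (f j (g y))]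
  have hgl : ∀ x y, dist (g x) (g y) ≤ C * (dist x y + 3 * C) := by
    intro x y
    refine (hlow' _ _).trans (mul_le_mul_of_nonneg_left ?_ hC0.le)
    have h1 := dist_triangle4 (h (g x)) x y (h (g y))
    have h2 := hg x
    rw [dist_comm] at h2
    linarith [hg y]
  have hgp : ∀ y, dist (g y) ptX ≤ C * (dist y ptY + P + 2 * C) := by
    intro y
    refine (hlow' _ _).trans (mul_le_mul_of_nonneg_left ?_ hC0.le)
    have h1 := dist_triangle4 (h (g y)) y ptY (h ptX)
    have h2 := hg y
    rw [dist_comm] at h2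
    linarith
  refine ⟨F, ?_, ?_, ?_, ?_, ?_⟩
  · intro y; simp [hF]
  · intro y
    obtain ⟨N, hN⟩ := hN (g y)
    refine ⟨N + 1, fun i hi => ?_⟩
    have h1 : i ≠ 0 := by omega
    simp [hF, h1, hN i (by omega)]
  · refine ⟨2 * (C + P) + C + C * A * (C * (3 * C) + 1) + C * A * C, by positivity, ?_⟩
    intro i x y
    have h1 := hclose2 i i x y
    have h2 : C * dist (f i (g x)) (f i (g y)) ≤
        C * (A * (C * (dist x y + 3 * C) + 1)) := by
      refine mul_le_mul_of_nonneg_left ((hlip i _ _).trans ?_) hC0.le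
      exact mul_le_mul_of_nonneg_left (by linarith [hgl x y]) hA.le
    have hd : 0 ≤ dist x y := dist_nonneg
    have h3 : 0 ≤ (2 * (C + P) + C + C * A * (C * (3 * C) + 1)) * dist x y := by positivity
    have h4 : 0 ≤ C * A * C := by positivity
    linear_combination h1 + h2 + h3 + h4
  · refine ⟨2 * (C + P) + (C * S + C), fun i y => ?_⟩
    have h1 := hclose2 i (i + 1) y y
    have h2 := mul_le_mul_of_nonneg_left (hS i (g y)) hC0.le
    linarith
  · set D := C + C * (P + 2 * C) + 1 with hD
    have hD0 : 0 < D := by positivity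
    refine ⟨C' * D ^ m + 1, by positivity, fun y => ?_⟩
    have hfin : {i : ℕ | f i (g y) ≠ f (i + 1) (g y)}.Finite := by
      obtain ⟨N, hN⟩ := hN (g y)
      refine (Set.finite_lt_nat N).subset fun i hi => ?_
      by_contra hlt
      simp only [Set.mem_setOf_eq, not_lt] at hlt
      exact hi (by rw [hN i hlt, hN (i + 1) (by omega)])
    have hsub : {i : ℕ | F i y ≠ F (i + 1) y} ⊆
        insert 0 {i : ℕ | f i (g y) ≠ f (i + 1) (g y)} := by
      intro i hi
      by_cases hi0 : i = 0
      · exact Or.inl hi0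
      · right
        intro he
        apply hi
        simp [hF, hi0, he]
    have h1 := (Set.ncard_le_ncard hsub (hfin.insert 0)).trans (Set.ncard_insert_le _ _)
    have h2 : (Set.ncard {i : ℕ | F i y ≠ F (i + 1) y} : ℝ) ≤
        Set.ncard {i : ℕ | f i (g y) ≠ f (i + 1) (g y)} + 1 := by exact_mod_cast h1
    have hd : 0 ≤ dist y ptY := dist_nonneg
    have h3 : dist (g y) ptX + 1 ≤ D * (dist y ptY + 1) := by
      have h4 := hgp y
      have h5 : 0 ≤ (C * (P + 2 * C) + 1) * dist y ptY := by positivity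
      rw [hD]
      linear_combination h4 + h5 + hC0.le
    have h6 : C' * (dist (g y) ptX + 1) ^ m ≤ C' * (D * (dist y ptY + 1)) ^ m := by
      gcongr
    have h7 : 1 ≤ (dist y ptY + 1) ^ m := one_le_pow₀ (by linarith)
    rw [mul_pow] at h6
    linear_combination h2 + hJ (g y) + h6 + h7
end

section
/- Let r ≥ 1 and let δ_g ∈ ℝ[F_r] denote the standard basis vector at g. There is a unique ℝ-linear map σ : ℝ[F_r] → ℝ[F_r]^r such that σ∘b_1 = id and b_1(σ(δ_g)) = δ_g − δ_1 for all g ∈ F_r. Moreover, for every g ∈ F_r, σ(δ_g) is a sum of exactly ℓ(g) distinct standard basis vectors with coefficients ±1: viewing σ(δ_g) as a finitely supported function on {1,…,r} × F_r, its support has exactly ℓ(g) elements, all of its nonzero values lie in {+1, −1}, and every (j, h) in its support satisfies ℓ(h) ≤ ℓ(g). -/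
/-- The word length `ℓ(g)` of an element of the free group. -/
def wlen {r : ℕ} (g : FreeGroup (Fin r)) : ℕ := g.toWord.length

/-- The map `b_1 : ℝ[F_r]^r → ℝ[F_r]`, `b_1(φ_1,…,φ_r)(g) = Σ_j (φ_j(g) - φ_j(g·s(j)))`,
where `ℝ[F_r]^r` is realised as finitely supported functions on `{1,…,r} × F_r`. -/
noncomputable def b1 (r : ℕ) :
    ((Fin r × FreeGroup (Fin r)) →₀ ℝ) →ₗ[ℝ] (FreeGroup (Fin r) →₀ ℝ) :=
  Finsupp.linearCombination ℝ
    (fun p => Finsupp.single p.2 1 - Finsupp.single (p.2 * (FreeGroup.of p.1)⁻¹) 1)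

noncomputable def actM {r : ℕ} (g : FreeGroup (Fin r)) :
    ((Fin r × FreeGroup (Fin r)) →₀ ℝ) ≃ₗ[ℝ] ((Fin r × FreeGroup (Fin r)) →₀ ℝ) :=
  Finsupp.domLCongr (Equiv.prodCongr (Equiv.refl _) (Equiv.mulLeft g))

lemma actM_single {r : ℕ} (g : FreeGroup (Fin r)) (j : Fin r) (h : FreeGroup (Fin r)) (c : ℝ) :
    actM g (Finsupp.single (j, h) c) = Finsupp.single (j, g * h) c := by
  simp [actM, Finsupp.domLCongr_single]

lemma actM_mul {r : ℕ} (g h : FreeGroup (Fin r)) (m) : actM (g * h) m = actM g (actM h m) := by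
  induction m using Finsupp.induction_linear with
  | zero => simp
  | add x y hx hy => simp [hx, hy]
  | single p c => obtain ⟨j, k⟩ := p; simp [actM_single, mul_assoc]

lemma actM_one {r : ℕ} (m) : actM (1 : FreeGroup (Fin r)) m = m := by
  induction m using Finsupp.induction_linear with
  | zero => simp
  | add x y hx hy => simp [hx, hy]
  | single p c => obtain ⟨j, k⟩ := p; simp [actM_single]

/-- The affine action of the free group attached to the Fox derivative. -/
noncomputable def aff (r : ℕ) :
    FreeGroup (Fin r) →* Equiv.Perm ((Fin r × FreeGroup (Fin r)) →₀ ℝ) :=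
  FreeGroup.lift fun j =>
    (actM (FreeGroup.of j)).toEquiv.trans
      (Equiv.addLeft (Finsupp.single (j, FreeGroup.of j) (1 : ℝ)))

lemma aff_of {r : ℕ} (j : Fin r) (m) :
    aff r (FreeGroup.of j) m = Finsupp.single (j, FreeGroup.of j) 1 + actM (FreeGroup.of j) m := by
  simp [aff]

noncomputable def foxD (r : ℕ) (g : FreeGroup (Fin r)) : (Fin r × FreeGroup (Fin r)) →₀ ℝ :=
  aff r g 0

lemma aff_eq {r : ℕ} (g : FreeGroup (Fin r)) : ∀ m, aff r g m = foxD r g + actM g m := by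
  induction g using FreeGroup.induction_on with
  | C1 => intro m; simp [foxD, actM_one]
  | of j => intro m; simp [foxD, aff_of]
  | inv_of j ih =>
    intro m
    have key : ∀ m, aff r (FreeGroup.of j)⁻¹ m
        = actM (FreeGroup.of j)⁻¹ (m - Finsupp.single (j, FreeGroup.of j) 1) := by
      intro m
      rw [map_inv, Equiv.Perm.inv_eq_iff_eq, aff_of, ← actM_mul]
      simp [actM_one]
    unfold foxD
    change aff r (FreeGroup.of j)⁻¹ m = aff r (FreeGroup.of j)⁻¹ 0 + actM (FreeGroup.of j)⁻¹ m
    rw [key, key]; simp only [map_sub, map_zero]; abel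
  | mul x y hx hy =>
    intro m
    have h : ∀ m, aff r (x * y) m = aff r x (aff r y m) := fun m => by simp
    unfold foxD
    rw [h, h, hy, hx, hx (aff r y 0), actM_mul, map_add]
    unfold foxD; abel

lemma foxD_mul {r : ℕ} (g h : FreeGroup (Fin r)) :
    foxD r (g * h) = foxD r g + actM g (foxD r h) := by
  rw [← aff_eq]; simp [foxD]

lemma foxD_of {r : ℕ} (j : Fin r) :
    foxD r (FreeGroup.of j) = Finsupp.single (j, FreeGroup.of j) 1 := by
  simp [foxD, aff_of]

lemma foxD_one {r : ℕ} : foxD r 1 = 0 := by simp [foxD]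

lemma b1_single {r : ℕ} (j : Fin r) (h : FreeGroup (Fin r)) :
    b1 r (Finsupp.single (j, h) 1)
      = Finsupp.single h 1 - Finsupp.single (h * (FreeGroup.of j)⁻¹) 1 := by
  simp [b1]

lemma foxD_step {r : ℕ} (j : Fin r) (h : FreeGroup (Fin r)) :
    foxD r h - foxD r (h * (FreeGroup.of j)⁻¹) = Finsupp.single (j, h) 1 := by
  have := foxD_mul (h * (FreeGroup.of j)⁻¹) (FreeGroup.of j)
  rw [foxD_of, actM_single, inv_mul_cancel_right] at this
  rw [this]; abel

/-- Induction along reduced words. -/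
lemma red_induction {r : ℕ} {P : FreeGroup (Fin r) → Prop} (one : P 1)
    (pos : ∀ g j, wlen (g * FreeGroup.of j) = wlen g + 1 → P g → P (g * FreeGroup.of j))
    (neg : ∀ g j, wlen (g * (FreeGroup.of j)⁻¹) = wlen g + 1 → P g →
      P (g * (FreeGroup.of j)⁻¹)) (g) : P g := by
  have main : ∀ L : List (Fin r × Bool), FreeGroup.IsReduced L → P (FreeGroup.mk L) := by
    intro L
    induction L using List.reverseRecOn with
    | nil => intro _; exact one
    | append_singleton L x ih =>
      intro hL
      have hL' : FreeGroup.IsReduced L := hL.infix (List.prefix_append L [x]).isInfix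
      have e : wlen (FreeGroup.mk (L ++ [x])) = wlen (FreeGroup.mk L) + 1 := by
        simp [wlen, FreeGroup.toWord_mk, hL.reduce_eq, hL'.reduce_eq]
      obtain ⟨j, b⟩ := x
      cases b
      · have : FreeGroup.mk (L ++ [(j, false)]) = FreeGroup.mk L * (FreeGroup.of j)⁻¹ := by
          simp [FreeGroup.of, FreeGroup.inv_mk, FreeGroup.invRev]
        rw [this] at e ⊢
        exact neg _ _ e (ih hL')
      · have : FreeGroup.mk (L ++ [(j, true)]) = FreeGroup.mk L * (FreeGroup.of j) := by
          simp [FreeGroup.of]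
        rw [this] at e ⊢
        exact pos _ _ e (ih hL')
  rw [← FreeGroup.mk_toWord (x := g)]
  exact main _ FreeGroup.isReduced_toWord

lemma b1_foxD {r : ℕ} (g : FreeGroup (Fin r)) :
    b1 r (foxD r g) = Finsupp.single g 1 - Finsupp.single 1 1 := by
  induction g using red_induction with
  | one => simp [foxD_one]
  | pos g j _ ih =>
    have := foxD_step j (g * FreeGroup.of j)
    rw [mul_inv_cancel_right, sub_eq_iff_eq_add] at this
    rw [this, map_add, ih, b1_single, mul_inv_cancel_right]; abel
  | neg g j _ ih =>
    have := foxD_step j g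
    rw [sub_eq_iff_eq_add, ← sub_eq_iff_eq_add'] at this
    rw [← this, map_sub, ih, b1_single]; abel

/-- The properties of a signed path, in a form suited to induction. -/
def Good {r : ℕ} (g : FreeGroup (Fin r)) (f : (Fin r × FreeGroup (Fin r)) →₀ ℝ) : Prop :=
  f.support.card = wlen g ∧ (∀ p ∈ f.support, f p = 1 ∨ f p = -1) ∧
    ∀ p ∈ f.support, wlen p.2 ≤ wlen g ∧ wlen (p.2 * (FreeGroup.of p.1)⁻¹) ≤ wlen g

lemma Good.add {r : ℕ} {g g' : FreeGroup (Fin r)} {f : (Fin r × FreeGroup (Fin r)) →₀ ℝ}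
    (hf : Good g f) (hw : wlen g' = wlen g + 1) (q : Fin r × FreeGroup (Fin r)) (c : ℝ)
    (hc : c = 1 ∨ c = -1) (hq : q ∉ f.support) (h1 : wlen q.2 ≤ wlen g')
    (h2 : wlen (q.2 * (FreeGroup.of q.1)⁻¹) ≤ wlen g') : Good g' (f + Finsupp.single q c) := by
  classical
  obtain ⟨ha, hb, hd⟩ := hf
  have hc0 : c ≠ 0 := by rcases hc with h | h <;> simp [h]
  have hs : (f + Finsupp.single q c).support = insert q f.support := by
    rw [Finsupp.support_add_eq, Finsupp.support_single q hc0, Finset.union_comm]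
    · rfl
    · rw [Finsupp.support_single q hc0]; simpa using hq
  have hq0 : f q = 0 := by simpa using hq
  refine ⟨?_, ?_, ?_⟩
  · rw [hs, Finset.card_insert_of_notMem hq, ha, hw]
  · intro p hp
    rw [hs, Finset.mem_insert] at hp
    rcases hp with rfl | hp
    · simpa [hq0] using hc
    · have : q ≠ p := by rintro rfl; exact hq hp
      simpa [Finsupp.single_eq_of_ne' this] using hb p hp
  · intro p hp
    rw [hs, Finset.mem_insert] at hp
    rcases hp with rfl | hp
    · exact ⟨h1, h2⟩
    · have := hd p hp; omega

lemma foxD_good {r : ℕ} (g : FreeGroup (Fin r)) : Good g (foxD r g) := by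
  induction g using red_induction with
  | one => simp [foxD_one, Good, wlen]
  | pos g j hw ih =>
    have := foxD_step j (g * FreeGroup.of j)
    rw [mul_inv_cancel_right, sub_eq_iff_eq_add'] at this
    rw [this]
    refine ih.add hw _ _ (Or.inl rfl) (fun h => ?_) le_rfl ?_
    · have := (ih.2.2 _ h).1; simp only at this; omega
    · simp only [mul_inv_cancel_right]; omega
  | neg g j hw ih =>
    have := foxD_step j g
    rw [sub_eq_iff_eq_add, ← sub_eq_iff_eq_add'] at this
    rw [← this, sub_eq_add_neg, ← Finsupp.single_neg]
    refine ih.add hw _ _ (Or.inr rfl) (fun h => ?_) (by simp only; omega) le_rfl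
    have := (ih.2.2 _ h).2; simp only at this; omega

noncomputable def sigmaF (r : ℕ) :
    (FreeGroup (Fin r) →₀ ℝ) →ₗ[ℝ] ((Fin r × FreeGroup (Fin r)) →₀ ℝ) :=
  Finsupp.linearCombination ℝ (foxD r)

lemma sigmaF_single {r : ℕ} (g : FreeGroup (Fin r)) :
    sigmaF r (Finsupp.single g 1) = foxD r g := by simp [sigmaF]

lemma sigmaF_b1 (r : ℕ) : sigmaF r ∘ₗ b1 r = LinearMap.id := by
  refine Finsupp.lhom_ext' fun p => LinearMap.ext_ring ?_
  obtain ⟨j, h⟩ := p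
  simp only [LinearMap.comp_apply, Finsupp.lsingle_apply, LinearMap.id_apply]
  rw [b1_single, map_sub, sigmaF_single, sigmaF_single, foxD_step]

lemma sigma_unique {r : ℕ}
    (σ : (FreeGroup (Fin r) →₀ ℝ) →ₗ[ℝ] ((Fin r × FreeGroup (Fin r)) →₀ ℝ))
    (h : ∀ g : FreeGroup (Fin r),
        b1 r (σ (Finsupp.single g 1)) = Finsupp.single g 1 - Finsupp.single 1 1) :
    σ = sigmaF r := by
  refine Finsupp.lhom_ext' fun g => LinearMap.ext_ring ?_
  simp only [LinearMap.comp_apply, Finsupp.lsingle_apply]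
  have inj : ∀ x, sigmaF r (b1 r x) = x := fun x => LinearMap.congr_fun (sigmaF_b1 r) x
  rw [← inj (σ _), h, ← b1_foxD, inj, sigmaF_single]

/-- For `r ≥ 1` there is a unique linear map `σ : ℝ[F_r] → ℝ[F_r]^r`
with `σ∘b_1 = id` and `b_1(σ(δ_g)) = δ_g - δ_1` for all `g`; moreover for this `σ`,
each `σ(δ_g)` is a sum of exactly `ℓ(g)` distinct standard basis vectors with
coefficients `±1`, and every `(j,h)` in its support satisfies `ℓ(h) ≤ ℓ(g)`. -/
theorem statement14 (r : ℕ) (hr : 1 ≤ r) :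
    (∃! σ : (FreeGroup (Fin r) →₀ ℝ) →ₗ[ℝ] ((Fin r × FreeGroup (Fin r)) →₀ ℝ),
      σ ∘ₗ b1 r = LinearMap.id ∧
      ∀ g : FreeGroup (Fin r),
        b1 r (σ (Finsupp.single g 1)) = Finsupp.single g 1 - Finsupp.single 1 1) ∧
    (∀ σ : (FreeGroup (Fin r) →₀ ℝ) →ₗ[ℝ] ((Fin r × FreeGroup (Fin r)) →₀ ℝ),
      (σ ∘ₗ b1 r = LinearMap.id ∧
        ∀ g : FreeGroup (Fin r),
          b1 r (σ (Finsupp.single g 1)) = Finsupp.single g 1 - Finsupp.single 1 1) →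
      ∀ g : FreeGroup (Fin r),
        (σ (Finsupp.single g 1)).support.card = wlen g ∧
        (∀ p ∈ (σ (Finsupp.single g 1)).support,
          σ (Finsupp.single g 1) p = 1 ∨ σ (Finsupp.single g 1) p = -1) ∧
        (∀ p ∈ (σ (Finsupp.single g 1)).support, wlen p.2 ≤ wlen g)) := by
  refine ⟨⟨sigmaF r, ⟨sigmaF_b1 r, fun g => ?_⟩, fun τ hτ => sigma_unique τ hτ.2⟩, ?_⟩
  · rw [sigmaF_single, b1_foxD]
  · intro σ hσ g
    rw [sigma_unique σ hσ.2, sigmaF_single]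
    obtain ⟨h1, h2, h3⟩ := foxD_good g
    exact ⟨h1, h2, fun p hp => (h3 p hp).1⟩
end

section
/- Let r ≥ 1 and let σ : ℝ[F_r] → ℝ[F_r]^r be the unique linear map with σ∘b_1 = id and b_1(σ(δ_g)) = δ_g − δ_1 for all g ∈ F_r. Then for every k ≥ 0 and every finitely supported φ : F_r → ℝ, writing σ(φ) = (ψ_1,…,ψ_r), one has Σ_{j=1}^r ‖ψ_j‖^k ≤ ‖φ‖^{k+1}, where ‖ψ‖^k := Σ_{g∈F_r} |ψ(g)|·(ℓ(g)+1)^k. Consequently σ extends to a bounded linear map Sch^{k+1}(F_r) → Sch^k(F_r)^r for every k ≥ 0. -/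
/-- Weighted ℓ¹ norm of a finitely supported function. -/
noncomputable def nrmW {α : Type*} (w : α → ℝ) (f : α →₀ ℝ) : ℝ :=
  ∑ a ∈ f.support, |f a| * w a

theorem nrmW_eq {α : Type*} (w : α → ℝ) (f : α →₀ ℝ) (s : Finset α) (h : f.support ⊆ s) :
    nrmW w f = ∑ a ∈ s, |f a| * w a := by
  unfold nrmW
  apply Finset.sum_subset h
  intro x _ hx
  rw [Finsupp.notMem_support_iff.mp hx]; simp

theorem nrmW_add_le {α : Type*} (w : α → ℝ) (hw : ∀ a, 0 ≤ w a) (f g : α →₀ ℝ) :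
    nrmW w (f + g) ≤ nrmW w f + nrmW w g := by
  classical
  rw [nrmW_eq w (f + g) (f.support ∪ g.support) Finsupp.support_add,
    nrmW_eq w f (f.support ∪ g.support) Finset.subset_union_left,
    nrmW_eq w g (f.support ∪ g.support) Finset.subset_union_right, ← Finset.sum_add_distrib]
  apply Finset.sum_le_sum
  intro a _
  rw [← add_mul, Finsupp.add_apply]
  exact mul_le_mul_of_nonneg_right (abs_add_le _ _) (hw a)

theorem nrmW_smul_le {α : Type*} (w : α → ℝ) (c : ℝ) (f : α →₀ ℝ) :
    nrmW w (c • f) = |c| * nrmW w f := by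
  rw [nrmW_eq w (c • f) f.support Finsupp.support_smul, nrmW, Finset.mul_sum]
  apply Finset.sum_congr rfl
  intro a _
  rw [Finsupp.smul_apply, smul_eq_mul, abs_mul, mul_assoc]

theorem nrmW_single {α : Type*} (w : α → ℝ) (a : α) (c : ℝ) :
    nrmW w (Finsupp.single a c) = |c| * w a := by
  classical
  rw [nrmW_eq w _ {a} Finsupp.support_single_subset]; simp

theorem nrmW_sum_le {α ι : Type*} (w : α → ℝ) (hw : ∀ a, 0 ≤ w a) (s : Finset ι)
    (f : ι → α →₀ ℝ) : nrmW w (∑ i ∈ s, f i) ≤ ∑ i ∈ s, nrmW w (f i) := by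
  classical
  induction s using Finset.induction_on with
  | empty => simp [nrmW]
  | insert a s ha ih =>
    rw [Finset.sum_insert ha, Finset.sum_insert ha]
    exact (nrmW_add_le w hw _ _).trans (by linarith)

theorem wlen_mk_le {r : ℕ} (L : List (Fin r × Bool)) : wlen (FreeGroup.mk L) ≤ L.length :=
  FreeGroup.norm_mk_le

theorem key_bound (r : ℕ) (k : ℝ) (hk : 0 ≤ k)
    (σ : (FreeGroup (Fin r) →₀ ℝ) →ₗ[ℝ] ((Fin r × FreeGroup (Fin r)) →₀ ℝ))
    (h1 : σ (Finsupp.single 1 1) = 0)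
    (hs : ∀ j h, σ (Finsupp.single h 1) =
      σ (Finsupp.single (h * (FreeGroup.of j)⁻¹) 1) + Finsupp.single (j, h) 1)
    (L : List (Fin r × Bool)) :
    nrmW (fun p => ((wlen p.2 : ℝ) + 1) ^ k) (σ (Finsupp.single (FreeGroup.mk L) 1)) ≤
      L.length * ((L.length : ℝ) + 1) ^ k := by
  have hw : ∀ p : Fin r × FreeGroup (Fin r), 0 ≤ ((wlen p.2 : ℝ) + 1) ^ k := fun p => by positivity
  induction L using List.reverseRecOn with
  | nil =>
    rw [← FreeGroup.one_eq_mk, h1]; simp [nrmW]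
  | append_singleton L x ih =>
    obtain ⟨j, b⟩ := x
    have hL := wlen_mk_le L
    have hL' := wlen_mk_le (L ++ [(j, b)])
    have hlen : (L ++ [(j, b)]).length = L.length + 1 := by simp
    rw [hlen] at hL' ⊢
    have hmono : (L.length : ℝ) * ((L.length : ℝ) + 1) ^ k ≤
        L.length * (((L.length + 1 : ℕ) : ℝ) + 1) ^ k := by
      gcongr; simp
    have hstep : ∀ g : FreeGroup (Fin r), wlen g ≤ L.length + 1 →
        ((wlen g : ℝ) + 1) ^ k ≤ (((L.length + 1 : ℕ) : ℝ) + 1) ^ k := by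
      intro g hg; gcongr
    have fin : ∀ (c : ℝ) (g : FreeGroup (Fin r)), |c| = 1 → wlen g ≤ L.length + 1 →
        σ (Finsupp.single (FreeGroup.mk (L ++ [(j, b)])) 1) =
          σ (Finsupp.single (FreeGroup.mk L) 1) + Finsupp.single (j, g) c →
        nrmW (fun p => ((wlen p.2 : ℝ) + 1) ^ k)
          (σ (Finsupp.single (FreeGroup.mk (L ++ [(j, b)])) 1)) ≤
        ((L.length + 1 : ℕ) : ℝ) * (((L.length + 1 : ℕ) : ℝ) + 1) ^ k := by
      intro c g hc hg he
      rw [he]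
      refine (nrmW_add_le _ hw _ _).trans ?_
      rw [nrmW_single, hc, one_mul]
      have h3 := hstep g hg
      have h4 : ((L.length + 1 : ℕ) : ℝ) * (((L.length + 1 : ℕ) : ℝ) + 1) ^ k =
        L.length * (((L.length + 1 : ℕ) : ℝ) + 1) ^ k + (((L.length + 1 : ℕ) : ℝ) + 1) ^ k := by
        rw [Nat.cast_succ]; ring
      rw [h4]
      exact add_le_add (ih.trans hmono) h3
    cases b with
    | true =>
      apply fin 1 (FreeGroup.mk (L ++ [(j, true)])) (by simp) hL'
      have := hs j (FreeGroup.mk (L ++ [(j, true)]))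
      rw [this]
      congr 4
      rw [← FreeGroup.mul_mk]
      change FreeGroup.mk L * FreeGroup.of j * _ = _
      simp
    | false =>
      apply fin (-1) (FreeGroup.mk L) (by simp) (by omega)
      have := hs j (FreeGroup.mk L)
      have e : FreeGroup.mk (L ++ [(j, false)]) = FreeGroup.mk L * (FreeGroup.of j)⁻¹ := by
        rw [← FreeGroup.mul_mk]; rfl
      rw [this, e, add_assoc, ← Finsupp.single_add]; simp

/-- Let `σ : ℝ[F_r] → ℝ[F_r]^r` be the unique linear map with
`σ∘b_1 = id` and `b_1(σ(δ_g)) = δ_g - δ_1`.  For every `k ≥ 0` and every finitely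
supported `φ`, one has `Σ_j ‖(σφ)_j‖^k ≤ ‖φ‖^{k+1}` for the weighted ℓ¹-norms
`‖ψ‖^k = Σ_g |ψ(g)|·(ℓ(g)+1)^k`; consequently `σ` extends to a bounded linear map
`Sch^{k+1}(F_r) → Sch^k(F_r)^r`. -/
theorem statement15 (r : ℕ) (hr : 1 ≤ r) (k : ℝ) (hk : 0 ≤ k)
    (σ : (FreeGroup (Fin r) →₀ ℝ) →ₗ[ℝ] ((Fin r × FreeGroup (Fin r)) →₀ ℝ))
    (hσ1 : σ ∘ₗ b1 r = LinearMap.id)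
    (hσ2 : ∀ g : FreeGroup (Fin r),
      b1 r (σ (Finsupp.single g 1)) = Finsupp.single g 1 - Finsupp.single 1 1) :
    ∀ φ : FreeGroup (Fin r) →₀ ℝ,
      ∑ p ∈ (σ φ).support, |σ φ p| * ((wlen p.2 : ℝ) + 1) ^ k ≤
        ∑ g ∈ φ.support, |φ g| * ((wlen g : ℝ) + 1) ^ (k + 1) := by
  have hσb : ∀ f, σ (b1 r f) = f := fun f => LinearMap.congr_fun hσ1 f
  have h1 : σ (Finsupp.single 1 1) = 0 := by
    rw [← hσb (σ (Finsupp.single 1 1)), hσ2]; simp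
  have hs : ∀ j h, σ (Finsupp.single h 1) =
      σ (Finsupp.single (h * (FreeGroup.of j)⁻¹) 1) + Finsupp.single (j, h) 1 := by
    intro j h
    have := hσb (Finsupp.single (j, h) 1)
    rw [b1, Finsupp.linearCombination_single, one_smul, map_sub] at this
    rw [← this]; abel
  intro φ
  have hw : ∀ p : Fin r × FreeGroup (Fin r), 0 ≤ ((wlen p.2 : ℝ) + 1) ^ k := fun p => by positivity
  change nrmW (fun p => ((wlen p.2 : ℝ) + 1) ^ k) (σ φ) ≤ _
  have hφ : σ φ = ∑ g ∈ φ.support, φ g • σ (Finsupp.single g 1) := by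
    conv_lhs => rw [← Finsupp.sum_single φ, Finsupp.sum, map_sum]
    apply Finset.sum_congr rfl
    intro g _
    rw [← map_smul]; simp
  rw [hφ]
  refine (nrmW_sum_le _ hw _ _).trans (Finset.sum_le_sum fun g _ => ?_)
  rw [nrmW_smul_le]
  refine mul_le_mul_of_nonneg_left ?_ (abs_nonneg _)
  have hb := key_bound r k hk σ h1 hs g.toWord
  rw [FreeGroup.mk_toWord] at hb
  refine hb.trans ?_
  change (wlen g : ℝ) * ((wlen g : ℝ) + 1) ^ k ≤ _
  rw [Real.rpow_add (by positivity), Real.rpow_one, mul_comm]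
  gcongr
  linarith
end

section
/- Let r ≥ 1 and k ≥ 0. Suppose φ_1, …, φ_r : F_r → ℝ satisfy Σ_{g∈F_r} |φ_j(g)|·(ℓ(g)+1)^k < ∞ for every j, and Σ_{j=1}^r (φ_j(g) − φ_j(g·s(j))) = 0 for every g ∈ F_r. Then φ_j = 0 for all j. In other words, the boundary map b_1 is injective on Sch^k(F_r)^r. -/
/-- Indicator of the half-tree of words not beginning with `s(j)⁻¹`. -/
noncomputable def halfInd {r : ℕ} (j : Fin r) (h : FreeGroup (Fin r)) : ℝ :=
  if (h⁻¹).toWord.getLast? = some (j, true) then 0 else 1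

lemma halfInd_sub {r : ℕ} (j i : Fin r) (h : FreeGroup (Fin r)) :
    halfInd j h - halfInd j (h * (FreeGroup.of i)⁻¹) = if i = j ∧ h = 1 then 1 else 0 := by
  have hm : (h * (FreeGroup.of i)⁻¹)⁻¹ = FreeGroup.of i * h⁻¹ := by group
  have h1 : h = 1 ↔ (h⁻¹).toWord = [] := by
    rw [FreeGroup.toWord_eq_nil_iff, inv_eq_one]
  have hw : (FreeGroup.of i * h⁻¹).toWord = FreeGroup.reduce ((i, true) :: (h⁻¹).toWord) := by
    rw [FreeGroup.toWord_mul, FreeGroup.toWord_of]; rfl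
  rw [FreeGroup.reduce.cons, FreeGroup.reduce_toWord] at hw
  unfold halfInd
  rw [hm, hw]
  simp only [h1]
  generalize (h⁻¹).toWord = w
  rcases w with _ | ⟨⟨a, b⟩, t⟩
  · by_cases hij : i = j <;> simp [hij]
  · by_cases hc : i = a ∧ true = !b
    · have hb : b = false := by simpa using hc.2
      subst hb
      rcases t with _ | ⟨c, t⟩
      · simp [hc.1]
      · simp [hc.1, List.getLast?_cons_cons]
    · simp only [hc, if_false, List.getLast?_cons_cons]
      simp

/-- Let `r ≥ 1`, `k ≥ 0` and suppose `φ_1,…,φ_r : F_r → ℝ` satisfy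
`Σ_g |φ_j(g)|·(ℓ(g)+1)^k < ∞` for every `j` and `Σ_j (φ_j(g) - φ_j(g·s(j))) = 0` for
every `g`.  Then all `φ_j = 0`: the boundary map `b_1` is injective on `Sch^k(F_r)^r`. -/
theorem statement16 (r : ℕ) (hr : 1 ≤ r) (k : ℝ) (hk : 0 ≤ k)
    (φ : Fin r → FreeGroup (Fin r) → ℝ)
    (hsum : ∀ j, Summable fun g => |φ j g| * ((wlen g : ℝ) + 1) ^ k)
    (hker : ∀ g : FreeGroup (Fin r),
      ∑ j : Fin r, (φ j g - φ j (g * FreeGroup.of j)) = 0) :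
    ∀ j, φ j = 0 := by
  have habs : ∀ j, Summable fun g => |φ j g| := by
    intro j
    refine Summable.of_nonneg_of_le (fun g => abs_nonneg _) (fun g => ?_) (hsum j)
    refine le_mul_of_one_le_right (abs_nonneg _) (Real.one_le_rpow ?_ hk)
    have : (0 : ℝ) ≤ (wlen g : ℝ) := Nat.cast_nonneg _
    linarith
  intro j
  funext g
  set χ : FreeGroup (Fin r) → ℝ := fun h => halfInd j (g⁻¹ * h) with hχ
  have hχb : ∀ h, |χ h| ≤ 1 := by
    intro h
    simp only [hχ, halfInd]
    split_ifs <;> simp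
  have hχd : ∀ i h, χ h - χ (h * (FreeGroup.of i)⁻¹) = if i = j ∧ h = g then 1 else 0 := by
    intro i h
    have := halfInd_sub j i (g⁻¹ * h)
    simp only [hχ]
    rw [← mul_assoc, this]
    have : g⁻¹ * h = 1 ↔ h = g := by rw [inv_mul_eq_one]; exact eq_comm
    simp only [this]
  have hbd : ∀ (i : Fin r) (ψ : FreeGroup (Fin r) → ℝ), (∀ h, |ψ h| ≤ 1) →
      Summable fun h => ψ h * φ i h := by
    intro i ψ hψ
    refine Summable.of_norm_bounded (habs i) (fun h => ?_)
    rw [Real.norm_eq_abs, abs_mul]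
    exact mul_le_of_le_one_left (abs_nonneg _) (hψ h)
  have key : ∀ i, HasSum (fun h => χ h * (φ i h - φ i (h * FreeGroup.of i)))
      (if i = j then φ j g else 0) := by
    intro i
    have s1 := hbd i χ hχb
    have s2 := hbd i (fun h => χ (h * (FreeGroup.of i)⁻¹)) (fun h => hχb _)
    have e2 : HasSum (fun h => χ h * φ i (h * FreeGroup.of i))
        (∑' h, χ (h * (FreeGroup.of i)⁻¹) * φ i h) := by
      have := (Equiv.mulRight (FreeGroup.of i)).hasSum_iff.mpr s2.hasSum
      simpa [Function.comp_def] using this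
    have h3 := s1.hasSum.sub e2
    have h4 := s1.hasSum.sub s2.hasSum
    have h5 : HasSum (fun h => χ h * φ i h - χ (h * (FreeGroup.of i)⁻¹) * φ i h)
        (if i = j then φ j g else 0) := by
      have : (fun h => χ h * φ i h - χ (h * (FreeGroup.of i)⁻¹) * φ i h)
          = fun h => if h = g then (if i = j then φ j g else 0) else 0 := by
        funext h
        rw [← sub_mul, hχd]
        by_cases a : i = j <;> by_cases b : h = g <;> simp [a, b]
      rw [this]
      exact hasSum_ite_eq g _
    rw [h4.unique h5] at h3
    simpa only [mul_sub] using h3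
  have tot := hasSum_sum (s := Finset.univ) (fun i _ => key i)
  simp only [← Finset.mul_sum, hker, mul_zero] at tot
  have := tot.unique hasSum_zero
  simpa using this
end

section
/- Let k ∈ ℕ. There exists a function ψ : ℤ → ℝ with Σ_{n∈ℤ} |ψ(n)|·(|n|+1)^k < ∞ and Σ_{n∈ℤ} ψ(n) = 0 such that there is no function φ : ℤ → ℝ with Σ_{n∈ℤ} |φ(n)|·(|n|+1)^k < ∞ and ψ(n) = φ(n) − φ(n+1) for all n ∈ ℤ. In other words, for the group ℤ the image of the map b_1 : Sch^k(ℤ) → Sch^k(ℤ), b_1(φ)(n) := φ(n) − φ(n+1), is a proper (dense) subspace of the kernel of the augmentation φ ↦ Σ_n φ(n), so the degree-zero homology of the tempered reduced chain complex of ℤ is nonzero. -/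
lemma aux_of_weighted (k : ℕ) (f : ℤ → ℝ)
    (h : Summable fun n : ℤ => |f n| * (|(n : ℝ)| + 1) ^ k) : Summable f := by
  refine Summable.of_norm_bounded h (fun n => ?_)
  rw [Real.norm_eq_abs]
  have : (1 : ℝ) ≤ (|(n : ℝ)| + 1) ^ k :=
    one_le_pow₀ (by linarith [abs_nonneg (n : ℝ)])
  exact le_mul_of_one_le_right (abs_nonneg _) this

lemma aux_sq : Summable fun n : ℤ => ((|(n : ℝ)| + 1) ^ 2)⁻¹ := by
  have h : Summable fun n : ℕ => (((n : ℝ) + 1) ^ 2)⁻¹ := by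
    have := (summable_nat_add_iff (f := fun n : ℕ => (((n : ℝ)) ^ 2)⁻¹) 1).2
      (Real.summable_nat_pow_inv.2 (by norm_num))
    simpa using this
  apply Summable.of_nat_of_neg <;> simpa using h

lemma aux_harm : ¬ Summable fun n : ℤ => (|(n : ℝ)| + 1)⁻¹ := by
  intro h
  have h1 : Summable fun n : ℕ => ((n : ℝ) + 1)⁻¹ := by
    simpa [Function.comp_def] using h.comp_injective (i := fun n : ℕ => (n : ℤ)) Nat.cast_injective
  refine Real.not_summable_natCast_inv ?_
  refine (summable_nat_add_iff 1).1 ?_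
  simpa using h1

lemma aux_bound (k : ℕ) (a b : ℝ) (ha : 1 ≤ a) (hb : 1 ≤ b) (hab : |a - b| ≤ 1) :
    |(a⁻¹) ^ (k + 1) - (b⁻¹) ^ (k + 1)| * a ^ k ≤ (2 * (k + 1) * 2 ^ k) * (a ^ 2)⁻¹ := by
  have ha0 : 0 < a := by linarith
  have hb0 : 0 < b := by linarith
  obtain ⟨h1, h2⟩ := abs_le.1 hab
  have hb2 : b⁻¹ ≤ 2 * a⁻¹ := by
    rw [← div_eq_mul_inv, inv_eq_one_div, div_le_div_iff₀ hb0 ha0]; linarith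
  have hai : 0 < a⁻¹ := inv_pos.2 ha0
  have hbi : 0 < b⁻¹ := inv_pos.2 hb0
  have hd : |a⁻¹ - b⁻¹| ≤ 2 * (a⁻¹ * a⁻¹) := by
    have : a⁻¹ - b⁻¹ = (b - a) * (a⁻¹ * b⁻¹) := by field_simp
    rw [this, abs_mul, abs_of_pos (mul_pos hai hbi), abs_sub_comm]
    nlinarith [mul_pos hai hbi]
  have hm : max |a⁻¹| |b⁻¹| ≤ 2 * a⁻¹ := by
    rw [abs_of_pos hai, abs_of_pos hbi]
    exact max_le (by linarith) hb2
  have key := abs_pow_sub_pow_le (a⁻¹) (b⁻¹) (k + 1)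
  have : |(a⁻¹) ^ (k + 1) - (b⁻¹) ^ (k + 1)| ≤
      2 * (a⁻¹ * a⁻¹) * ((k + 1 : ℕ) : ℝ) * (2 * a⁻¹) ^ k := by
    refine key.trans ?_
    simp only [Nat.add_sub_cancel]
    gcongr
  calc _ ≤ 2 * (a⁻¹ * a⁻¹) * ((k + 1 : ℕ) : ℝ) * (2 * a⁻¹) ^ k * a ^ k := by gcongr
    _ = _ := by
      push_cast
      rw [mul_pow, inv_pow]
      field_simp



/-- For every `k ∈ ℕ` there is a function `ψ : ℤ → ℝ` with
`Σ_n |ψ(n)|·(|n|+1)^k < ∞` and `Σ_n ψ(n) = 0` such that no `φ : ℤ → ℝ` with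
`Σ_n |φ(n)|·(|n|+1)^k < ∞` satisfies `ψ(n) = φ(n) - φ(n+1)` for all `n`.  Thus the image
of `b_1 : Sch^k(ℤ) → Sch^k(ℤ)`, `b_1(φ)(n) = φ(n) - φ(n+1)`, is a proper (dense) subspace
of the kernel of the augmentation, and the degree-zero homology of the tempered reduced
chain complex of `ℤ` is nonzero. -/
theorem statement17 (k : ℕ) :
    ∃ ψ : ℤ → ℝ,
      (Summable fun n : ℤ => |ψ n| * (|(n : ℝ)| + 1) ^ k) ∧
      Summable ψ ∧ (∑' n : ℤ, ψ n = 0) ∧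
      ¬ ∃ φ : ℤ → ℝ,
        (Summable fun n : ℤ => |φ n| * (|(n : ℝ)| + 1) ^ k) ∧
        ∀ n : ℤ, ψ n = φ n - φ (n + 1) := by
  set Φ : ℤ → ℝ := fun n => ((|(n : ℝ)| + 1)⁻¹) ^ (k + 1) with hΦ
  have hw : Summable fun n : ℤ => |Φ n - Φ (n + 1)| * (|(n : ℝ)| + 1) ^ k := by
    refine Summable.of_nonneg_of_le (fun n => by positivity) (fun n => ?_)
      (aux_sq.mul_left (2 * ((k : ℝ) + 1) * 2 ^ k))
    refine aux_bound k _ _ (by linarith [abs_nonneg (n : ℝ)])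
      (by linarith [abs_nonneg ((n + 1 : ℤ) : ℝ)]) ?_
    have := abs_abs_sub_abs_le (n : ℝ) ((n + 1 : ℤ) : ℝ)
    push_cast at this ⊢
    simpa using this
  have hs := aux_of_weighted k _ hw
  refine ⟨fun n => Φ n - Φ (n + 1), hw, hs, ?_, ?_⟩
  · have h1 := (Equiv.subLeft (-1 : ℤ)).tsum_eq (fun n => Φ n - Φ (n + 1))
    have h2 : ∀ n : ℤ, Φ (Equiv.subLeft (-1 : ℤ) n) - Φ (Equiv.subLeft (-1 : ℤ) n + 1)
        = -(Φ n - Φ (n + 1)) := by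
      intro n
      have e : ∀ m : ℤ, Φ (-m) = Φ m := by intro m; simp [hΦ]
      rw [Equiv.subLeft_apply, show (-1 - n : ℤ) = -(n + 1) by ring,
        show (-(n + 1) + 1 : ℤ) = -n by ring, e, e]
      ring
    simp only [h2] at h1
    rw [tsum_neg] at h1
    linarith
  · rintro ⟨φ, hφ, h⟩
    simp only at h
    have hc : ∀ n : ℕ, φ n - Φ n = φ 0 - Φ 0 := by
      intro n
      induction n with
      | zero => simp
      | succ m ih => have := h m; push_cast; linarith
    have hc' : ∀ n : ℕ, φ (-n) - Φ (-n) = φ 0 - Φ 0 := by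
      intro n
      induction n with
      | zero => simp
      | succ m ih =>
        have := h (-(m + 1))
        simp only [show (-((m : ℤ) + 1) + 1) = -m by ring] at this
        push_cast; linarith
    have hφ0 : Filter.Tendsto (fun n : ℕ => φ n) Filter.atTop (nhds 0) :=
      ((aux_of_weighted k φ hφ).comp_injective
        (i := fun n : ℕ => (n : ℤ)) Nat.cast_injective).tendsto_atTop_zero
    have hΦ0 : Filter.Tendsto (fun n : ℕ => Φ n) Filter.atTop (nhds 0) := by
      have := (tendsto_one_div_add_atTop_nhds_zero_nat (𝕜 := ℝ)).pow (k + 1)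
      simpa [hΦ] using this
    have h0 : φ 0 - Φ 0 = 0 := by
      have := hφ0.sub hΦ0
      simp only [hc, sub_zero] at this
      exact tendsto_nhds_unique tendsto_const_nhds this
    have heq : ∀ n : ℤ, φ n = Φ n := by
      intro n
      obtain ⟨m, rfl | rfl⟩ := n.eq_nat_or_neg
      · linarith [hc m]
      · linarith [hc' m]
    apply aux_harm
    refine hφ.congr (fun n => ?_)
    have hp : 0 < |(n : ℝ)| + 1 := by positivity
    rw [heq n, hΦ]
    simp only
    rw [abs_of_pos (by positivity), inv_pow, pow_succ]
    field_simp
end
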